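/- arXiv:2505.04342 — 12 statements merged into one kernel-verified Lean document; each statement's English description precedes it below -/
import Mathlib

section
/- For each 1 ≤ i ≤ n, let a be the least common multiple of the set of integers { r(v_k v_j) : v_k v_j is an edge of G with j < i and k ≥ i } ∪ { m(v_k) : k ≥ i }. Then the vertex labeling f defined by f(v_t) = a for all t ≥ i and f(v_s) = 0 for all s < i is a spline on (G, m, r) (a constant flow-up class). -/
/-- for each vertex index `i`, letting `a` be the lcm of the set
`{ r (v_k v_j) : v_k v_j an edge with j < i ≤ k } ∪ { m v_k : k ≥ i }`,
the labeling with value `a` on the vertices `v_t`, `t ≥ i`, and `0` on the vertices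
`v_s`, `s < i`, is a spline (a constant flow-up class). -/
theorem constant_flowup_exists {n : ℕ}
    (G : SimpleGraph (Fin n)) [DecidableRel G.Adj]
    (m : Fin n → ℤ) (r : Fin n → Fin n → ℤ) (hr : ∀ u w, r u w = r w u)
    (i : Fin n) :
    let a : ℤ := lcm
      ((Finset.univ.filter
          (fun p : Fin n × Fin n => G.Adj p.1 p.2 ∧ p.2 < i ∧ i ≤ p.1)).lcm
        (fun p => r p.1 p.2))
      ((Finset.univ.filter (fun k : Fin n => i ≤ k)).lcm m)
    let f : Fin n → ℤ := fun v => if v < i then 0 else a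
    (∀ v, m v ∣ f v) ∧ (∀ u w, G.Adj u w → r u w ∣ f u - f w) := by
  intro a f
  have hm (k : Fin n) (hk : i ≤ k) : m k ∣ a :=
    (Finset.dvd_lcm (by simpa using hk)).trans (dvd_lcm_right _ _)
  have hcross (k j : Fin n) (hkj : G.Adj k j) (hj : j < i) (hk : i ≤ k) : r k j ∣ a :=
    (Finset.dvd_lcm (f := fun p : Fin n × Fin n => r p.1 p.2) (b := (k, j))
      (by simp [hkj, hj, hk])).trans (dvd_lcm_left _ _)
  refine ⟨fun v => ?_, fun u w huw => ?_⟩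
  · by_cases hv : v < i
    · simp [f, hv]
    · simpa [f, hv] using hm v (not_lt.mp hv)
  · by_cases hu : u < i <;> by_cases hw : w < i
    · simp [f, hu, hw]
    · simpa [f, hu, hw, hr u w] using hcross w u huw.symm hu (not_lt.mp hw)
    · simpa [f, hu, hw] using hcross u w huw hw (not_lt.mp hu)
    · simp [f, hu, hw]
end

section
/- Suppose that for each 1 ≤ i ≤ n, F^(i) is a spline on (G, m, r) with F^(i)(v_s) = 0 for all s < i and F^(i)(v_i) ≠ 0. Then the following are equivalent: (a) every spline f on (G, m, r) can be written uniquely as f = a_1 F^(1) + ⋯ + a_n F^(n) with a_1, …, a_n ∈ ℤ (i.e., {F^(1), …, F^(n)} is a ℤ-module basis of the module of splines); (b) for every 1 ≤ i ≤ n and every spline A on (G, m, r) with A(v_s) = 0 for all s < i, the integer F^(i)(v_i) divides A(v_i). -/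
/-- The coefficients of a combination of flow-up vectors vanish below `i` as soon as the
combination itself vanishes below `i`. -/
theorem coeff_eq_zero_of_flow_up {n : ℕ} {F : Fin n → Fin n → ℤ}
    (hFflow : ∀ i s, s < i → F i s = 0) (hFne : ∀ i, F i i ≠ 0)
    {a : Fin n → ℤ} {i : Fin n} (h : ∀ s, s < i → ∑ j, a j * F j s = 0) :
    ∀ s, s < i → a s = 0 := by
  intro s
  induction s using WellFoundedLT.induction with
  | ind s ih =>
    intro hs
    have hsum := h s hs
    rw [Finset.sum_eq_single s] at hsum
    · exact (mul_eq_zero.mp hsum).resolve_right (hFne s)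
    · intro j _ hj
      rcases lt_or_gt_of_ne hj with hlt | hgt
      · rw [ih j hlt (hlt.trans hs), zero_mul]
      · rw [hFflow j s hgt, mul_zero]
    · simp

/-- If a combination of flow-up vectors vanishes below `i`, its value at `i` is the `i`-th
coefficient times the leading entry of the `i`-th vector. -/
theorem sum_eq_leading_of_flow_up {n : ℕ} {F : Fin n → Fin n → ℤ}
    (hFflow : ∀ i s, s < i → F i s = 0) (hFne : ∀ i, F i i ≠ 0)
    {a : Fin n → ℤ} {i : Fin n} (h : ∀ s, s < i → ∑ j, a j * F j s = 0) :
    ∑ j, a j * F j i = a i * F i i := by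
  refine Finset.sum_eq_single i (fun j _ hj => ?_) (by simp)
  rcases lt_or_gt_of_ne hj with hlt | hgt
  · rw [coeff_eq_zero_of_flow_up hFflow hFne h j hlt, zero_mul]
  · rw [hFflow j i hgt, mul_zero]

/-- Flow-up vectors with nonzero leading entries have at most one combination of given value. -/
theorem coeff_unique_of_flow_up {n : ℕ} {F : Fin n → Fin n → ℤ}
    (hFflow : ∀ i s, s < i → F i s = 0) (hFne : ∀ i, F i i ≠ 0)
    {a b : Fin n → ℤ} (h : ∀ v, ∑ j, a j * F j v = ∑ j, b j * F j v) : a = b := by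
  have hz : ∀ v, ∑ j, (a j - b j) * F j v = 0 := fun v => by
    simp only [sub_mul, Finset.sum_sub_distrib, h v, sub_self]
  funext i
  have hi := sum_eq_leading_of_flow_up (a := fun j => a j - b j) hFflow hFne
    (i := i) (fun s _ => hz s)
  rw [hz i] at hi
  exact sub_eq_zero.mp ((mul_eq_zero.mp hi.symm).resolve_right (hFne i))

/-- A subgroup of `Fin n → ℤ` containing flow-up vectors whose leading entries divide those of
every member is contained in their span. -/
theorem mem_span_of_leading_dvd {n : ℕ} {F : Fin n → Fin n → ℤ}
    (hFflow : ∀ i s, s < i → F i s = 0) (S : Submodule ℤ (Fin n → ℤ)) (hFS : ∀ i, F i ∈ S)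
    (hdvd : ∀ i, ∀ A ∈ S, (∀ s, s < i → A s = 0) → F i i ∣ A i)
    {f : Fin n → ℤ} (hf : f ∈ S) : f ∈ Submodule.span ℤ (Set.range F) := by
  suffices h : ∀ k ≤ n, ∀ A ∈ S, (∀ s : Fin n, s.val < k → A s = 0) →
      A ∈ Submodule.span ℤ (Set.range F) from
    h 0 n.zero_le f hf (fun s hs => absurd hs s.val.not_lt_zero)
  intro k hk
  induction hk using Nat.decreasingInduction with
  | self =>
    intro A _ hA
    have hA0 : A = 0 := funext fun s => hA s s.isLt
    exact hA0 ▸ Submodule.zero_mem _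
  | of_succ k hk ih =>
    intro A hAS hA
    obtain ⟨c, hc⟩ := hdvd ⟨k, hk⟩ A hAS (fun s hs => hA s hs)
    have hmem := ih (A - c • F ⟨k, hk⟩) (S.sub_mem hAS (S.smul_mem c (hFS _))) (by
      intro s hs
      rcases Nat.lt_succ_iff_lt_or_eq.mp hs with hlt | heq
      · simp [hA s hlt, hFflow ⟨k, hk⟩ s hlt]
      · obtain rfl : s = ⟨k, hk⟩ := Fin.ext heq
        simp [hc, mul_comm])
    have hF : F ⟨k, hk⟩ ∈ Submodule.span ℤ (Set.range F) :=
      Submodule.subset_span (Set.mem_range_self _)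
    simpa using Submodule.add_mem _ hmem (Submodule.smul_mem _ c hF)

/-- The module of integer splines on `(G, m, r)`. -/
def splineModule {V : Type*} (G : SimpleGraph V) (m : V → ℤ) (r : V → V → ℤ) :
    Submodule ℤ (V → ℤ) where
  carrier := {f | (∀ v, m v ∣ f v) ∧ ∀ u w, G.Adj u w → r u w ∣ f u - f w}
  zero_mem' := by simp
  add_mem' {f g} hf hg := by
    refine ⟨fun v => dvd_add (hf.1 v) (hg.1 v), fun u w h => ?_⟩
    simpa only [Pi.add_apply, add_sub_add_comm] using dvd_add (hf.2 u w h) (hg.2 u w h)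
  smul_mem' c f hf := by
    refine ⟨fun v => (hf.1 v).mul_left c, fun u w h => ?_⟩
    simpa only [Pi.smul_apply, smul_eq_mul, mul_sub] using (hf.2 u w h).mul_left c

/-- basis condition. Given flow-up splines `F⁽¹⁾, …, F⁽ⁿ⁾`
(`F i` vanishes below `i` and `F i i ≠ 0`), the set `{F⁽¹⁾, …, F⁽ⁿ⁾}` is a
ℤ-module basis of the module of splines (every spline is a unique ℤ-linear
combination of them) iff for every `i` and every spline `A` vanishing below `i`,
`F i i` divides `A i`. -/
theorem basis_condition {n : ℕ} (G : SimpleGraph (Fin n))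
    (m : Fin n → ℤ) (r : Fin n → Fin n → ℤ) (hr : ∀ u w, r u w = r w u)
    (F : Fin n → Fin n → ℤ)
    (hFspline : ∀ i, (∀ v, m v ∣ F i v) ∧
      ∀ u w, G.Adj u w → r u w ∣ F i u - F i w)
    (hFflow : ∀ i s, s < i → F i s = 0)
    (hFne : ∀ i, F i i ≠ 0) :
    (∀ f : Fin n → ℤ,
        ((∀ v, m v ∣ f v) ∧ ∀ u w, G.Adj u w → r u w ∣ f u - f w) →
        ∃! a : Fin n → ℤ, ∀ v, f v = ∑ j, a j * F j v)
    ↔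
    (∀ (i : Fin n) (A : Fin n → ℤ),
        ((∀ v, m v ∣ A v) ∧ ∀ u w, G.Adj u w → r u w ∣ A u - A w) →
        (∀ s, s < i → A s = 0) → F i i ∣ A i) := by
  constructor
  · intro h i A hA hAi
    obtain ⟨a, ha, -⟩ := h A hA
    rw [ha i, sum_eq_leading_of_flow_up hFflow hFne (fun s hs => (ha s).symm.trans (hAi s hs))]
    exact dvd_mul_left _ _
  · intro h f hf
    have hspan := mem_span_of_leading_dvd hFflow (splineModule G m r) hFspline h hf
    obtain ⟨a, ha⟩ := (Submodule.mem_span_range_iff_exists_fun ℤ).mp hspan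
    have hsum : ∀ v, f v = ∑ j, a j * F j v := fun v => by
      simp [← ha, Finset.sum_apply]
    exact ⟨a, hsum, fun b hb =>
      coeff_unique_of_flow_up hFflow hFne fun v => (hb v).symm.trans (hsum v)⟩
end

section
/- Let 1 ≤ i ≤ n and let f = (f_1, …, f_n) be a spline on the edge-labeled path P_n with f_s = 0 for all s < i. Then D_i divides f_i. -/
/-- `D i` (0-indexed): the lcm of `m i`, `r (i-1)` (with convention `r₋₁ = 1`),
and the integers `gcd (m j) (gcd (r i, …, r (j-1)))` for `i + 1 ≤ j ≤ n - 1`. -/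
def pathD (n : ℕ) (m r : ℕ → ℤ) (i : ℕ) : ℤ :=
  lcm (lcm (m i) (if i = 0 then 1 else r (i - 1)))
    ((Finset.Ico (i + 1) n).lcm (fun j => gcd (m j) ((Finset.Ico i j).gcd r)))

theorem dvd_sub_of_dvd_edge_differences {r f : ℕ → ℤ} {d : ℤ} {i j : ℕ} (hij : i ≤ j)
    (hd : ∀ k ∈ Finset.Ico i j, d ∣ r k)
    (hr : ∀ k ∈ Finset.Ico i j, r k ∣ f (k + 1) - f k) : d ∣ f j - f i := by
  rw [← Finset.sum_Ico_sub f hij]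
  exact Finset.dvd_sum fun k hk => (hd k hk).trans (hr k hk)

/-- if `f` is a spline on the edge-labeled path `Pₙ`
(vertices `0, …, n-1`, vertex labels `m`, edge labels `r`)
vanishing at all vertices below `i`, then `D i` divides `f i`. -/
theorem path_flowup_leading_entry_multiple (n : ℕ) (hn : 1 ≤ n) (m r : ℕ → ℤ)
    (i : ℕ) (hi : i < n) (f : ℕ → ℤ)
    (hm : ∀ j < n, m j ∣ f j)
    (hredge : ∀ j, j + 1 < n → r j ∣ f (j + 1) - f j)
    (hzero : ∀ s < i, f s = 0) :
    pathD n m r i ∣ f i := by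
  refine lcm_dvd (lcm_dvd (hm i hi) ?_) (Finset.lcm_dvd fun j hj => ?_)
  · split_ifs with h
    · exact one_dvd _
    · have hi' : i - 1 + 1 = i := Nat.sub_add_cancel (Nat.pos_of_ne_zero h)
      have he := hredge (i - 1) (hi'.symm ▸ hi)
      rwa [hi', hzero (i - 1) (by omega), sub_zero] at he
  · rw [Finset.mem_Ico] at hj
    have hsub := dvd_sub_of_dvd_edge_differences (f := f) (by omega : i ≤ j)
      (fun k hk => (gcd_dvd_right (m j) _).trans (Finset.gcd_dvd hk))
      (fun k hk => hredge k (by rw [Finset.mem_Ico] at hk; omega))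
    exact (dvd_sub_right ((gcd_dvd_left _ _).trans (hm j hj.2))).mp hsub
end

section
/- Let f = (f_1, …, f_n) be any spline on the edge-labeled path P_n. Then for every 1 ≤ i ≤ n, the integer E_i = lcm( m_i, gcd(m_{i+1}, r_i), gcd(m_{i+2}, gcd(r_i, r_{i+1})), …, gcd(m_n, gcd(r_i, r_{i+1}, …, r_{n−1})) ) divides f_i (for i = n this reads m_n divides f_n). -/
/-- `E i` (0-indexed): the lcm of `m i` and the integers
`gcd (m j) (gcd (r i, …, r (j-1)))` for `i + 1 ≤ j ≤ n - 1`. -/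
def pathE (n : ℕ) (m r : ℕ → ℤ) (i : ℕ) : ℤ :=
  lcm (m i)
    ((Finset.Ico (i + 1) n).lcm (fun j => gcd (m j) ((Finset.Ico i j).gcd r)))

/-- A common divisor of the increments of `f` on `[i, j)` divides `f j - f i`. -/
theorem dvd_sub_of_forall_dvd_succ_sub {R : Type*} [CommRing R] {d : R} {f : ℕ → R} {i j : ℕ}
    (hij : i ≤ j) (h : ∀ k ∈ Finset.Ico i j, d ∣ f (k + 1) - f k) : d ∣ f j - f i := by
  rw [← Finset.sum_Ico_sub f hij]
  exact Finset.dvd_sum h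

/-- if `f` is a spline on the edge-labeled path `Pₙ`
(vertices `0, …, n-1`, vertex labels `m`, edge labels `r`), then for every
vertex `i`, `E i` divides `f i`. -/
theorem path_entry_multiple (n : ℕ) (hn : 1 ≤ n) (m r : ℕ → ℤ) (f : ℕ → ℤ)
    (hm : ∀ j < n, m j ∣ f j)
    (hredge : ∀ j, j + 1 < n → r j ∣ f (j + 1) - f j) :
    ∀ i < n, pathE n m r i ∣ f i := by
  intro i hi
  refine lcm_dvd (hm i hi) (Finset.lcm_dvd fun j hj => ?_)
  obtain ⟨hij, hjn⟩ := Finset.mem_Ico.mp hj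
  have hsub : gcd (m j) ((Finset.Ico i j).gcd r) ∣ f j - f i := by
    refine dvd_sub_of_forall_dvd_succ_sub (by lia) fun k hk => ?_
    have hkj := (Finset.mem_Ico.mp hk).2
    exact ((gcd_dvd_right _ _).trans (Finset.gcd_dvd hk)).trans (hredge k (by lia))
  exact (dvd_sub_right ((gcd_dvd_left _ _).trans (hm j hjn))).mp hsub
end

section
/- For every 1 ≤ i ≤ n there exists a spline f = (f_1, …, f_n) on the edge-labeled path P_n such that f_s = 0 for all s < i and f_i = D_i. -/
theorem int_gcd_lcm_dvd_of_gcd_dvd {a b r x : ℤ} (ha : gcd a r ∣ x) (hb : gcd b r ∣ x) :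
    gcd (lcm a b) r ∣ x := by
  set d := gcd (lcm a b) r with hd
  have hdr : d ∣ r := gcd_dvd_right _ _
  have hdl : d ∣ lcm a b := gcd_dvd_left _ _
  obtain ⟨a', b', ea, eb, hu⟩ := extract_gcd a b
  obtain ⟨u, v, huv⟩ := (gcd_isUnit_iff a' b').1 hu
  have hab : d ∣ a * b' := hdl.trans
    (lcm_dvd (dvd_mul_right _ _) ⟨a', by linear_combination b' * ea - a' * eb⟩)
  have hba : d ∣ b * a' := hdl.trans
    (lcm_dvd ⟨b', by linear_combination a' * eb - b' * ea⟩ (dvd_mul_right _ _))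
  have dvd_mul_of_gcd_dvd : ∀ {s t : ℤ}, d ∣ s * t → gcd s r ∣ x → d ∣ x * t := by
    intro s t hst hs
    refine dvd_trans ?_ (mul_dvd_mul_right hs t)
    exact (dvd_gcd hst (hdr.mul_right t)).trans (gcd_mul_right' t s r).dvd
  have hx : x = u * (x * a') + v * (x * b') := by linear_combination -x * huv
  rw [hx]
  exact dvd_add ((dvd_mul_of_gcd_dvd hba hb).mul_left u) ((dvd_mul_of_gcd_dvd hab ha).mul_left v)

theorem int_gcd_finset_lcm_dvd_of_gcd_dvd {ι : Type*} (s : Finset ι) (g : ι → ℤ) {r x : ℤ}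
    (h : ∀ j ∈ s, gcd (g j) r ∣ x) : gcd (s.lcm g) r ∣ x := by
  classical
  induction s using Finset.induction_on with
  | empty => simp
  | insert j s _ ih =>
    rw [Finset.lcm_insert]
    exact int_gcd_lcm_dvd_of_gcd_dvd (h j (by simp)) (ih fun k hk => h k (by simp [hk]))

theorem int_exists_dvd_and_dvd_sub_of_gcd_dvd {l r x : ℤ} (h : gcd l r ∣ x) :
    ∃ y, l ∣ y ∧ r ∣ y - x := by
  obtain ⟨c, rfl⟩ := h
  obtain ⟨u, v, huv⟩ := exists_gcd_eq_mul_add_mul l r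
  exact ⟨l * u * c, ⟨u * c, by ring⟩, -v * c, by linear_combination -c * huv⟩

/-- A value at vertex `i` divisible by all the path gcds extends to a spline on the vertices
`i, …, n - 1`. -/
theorem path_exists_extension (n : ℕ) (m r : ℕ → ℤ) (k : ℕ) :
    ∀ (i : ℕ) (x : ℤ), n ≤ i + k → m i ∣ x →
      (∀ j, i < j → j < n → gcd (m j) ((Finset.Ico i j).gcd r) ∣ x) →
      ∃ f : ℕ → ℤ, (∀ j, i ≤ j → j < n → m j ∣ f j) ∧
        (∀ j, i ≤ j → j + 1 < n → r j ∣ f (j + 1) - f j) ∧ f i = x := by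
  induction k with
  | zero =>
    intro i x hn _ _
    exact ⟨fun _ => x, fun j _ _ => by omega, fun j _ _ => by omega, rfl⟩
  | succ k ih =>
    intro i x hn hm hx
    by_cases hi : i + 1 < n
    · have hgcd : gcd ((Finset.Ico (i + 1) n).lcm
          fun j => gcd (m j) ((Finset.Ico (i + 1) j).gcd r)) (r i) ∣ x := by
        refine int_gcd_finset_lcm_dvd_of_gcd_dvd _ _ fun j hj => ?_
        rw [Finset.mem_Ico] at hj
        refine dvd_trans ?_ (hx j (by omega) hj.2)
        rw [← Finset.insert_Ico_add_one_left_eq_Ico (show i < j by omega), Finset.gcd_insert]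
        exact dvd_gcd ((gcd_dvd_left _ _).trans (gcd_dvd_left _ _))
          (dvd_gcd (gcd_dvd_right _ _) ((gcd_dvd_left _ _).trans (gcd_dvd_right _ _)))
      obtain ⟨y, hy, hyx⟩ := int_exists_dvd_and_dvd_sub_of_gcd_dvd hgcd
      rw [Finset.lcm_dvd_iff] at hy
      obtain ⟨f, hfm, hfr, hfi⟩ := ih (i + 1) y (by omega)
        (by simpa using hy (i + 1) (by simp [hi]))
        (fun j hj hjn => hy j (Finset.mem_Ico.2 ⟨hj.le, hjn⟩))
      refine ⟨Function.update f i x, fun j hj hjn => ?_, fun j hj hjn => ?_, by simp⟩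
      · obtain rfl | hij := hj.eq_or_lt
        · simpa using hm
        · rw [Function.update_of_ne hij.ne']
          exact hfm j hij hjn
      · rw [Function.update_of_ne (show j + 1 ≠ i by omega)]
        obtain rfl | hij := hj.eq_or_lt
        · simpa [hfi] using hyx
        · rw [Function.update_of_ne hij.ne']
          exact hfr j hij hjn
    · refine ⟨fun _ => x, fun j _ _ => ?_, fun j _ _ => by omega, rfl⟩
      obtain rfl : j = i := by omega
      exact hm


/-- for every `i < n` there is a spline `f` on the edge-labeled
path `Pₙ` (vertices `0, …, n-1`, vertex labels `m`, edge labels `r`) with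
`f s = 0` for all `s < i` and `f i = D i`. -/
theorem path_minimal_flowup_exists (n : ℕ) (hn : 1 ≤ n) (m r : ℕ → ℤ)
    (i : ℕ) (hi : i < n) :
    ∃ f : ℕ → ℤ,
      (∀ j < n, m j ∣ f j) ∧
      (∀ j, j + 1 < n → r j ∣ f (j + 1) - f j) ∧
      (∀ s < i, f s = 0) ∧ f i = pathD n m r i := by
  obtain ⟨f, hfm, hfr, hfi⟩ := path_exists_extension n m r n i (pathD n m r i) (by omega)
    ((dvd_lcm_left _ _).trans (dvd_lcm_left _ _))
    (fun j hj hjn => (Finset.dvd_lcm (f := fun j => gcd (m j) ((Finset.Ico i j).gcd r))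
      (Finset.mem_Ico.2 ⟨hj, hjn⟩)).trans (dvd_lcm_right _ _))
  refine ⟨fun s => if s < i then 0 else f s, fun j hj => ?_, fun j hj => ?_,
    fun s hs => if_pos hs, by simpa using hfi⟩
  · by_cases hji : j < i
    · simp [hji]
    · simpa [hji] using hfm j (by omega) hj
  · by_cases hji : j < i
    · by_cases hji' : j + 1 < i
      · simp [hji, hji']
      · obtain rfl : i = j + 1 := by omega
        have hr : r j ∣ pathD n m r (j + 1) := by
          have h := dvd_lcm_right (m (j + 1)) (if j + 1 = 0 then 1 else r (j + 1 - 1))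
          simp only [Nat.add_sub_cancel, Nat.succ_ne_zero, if_false] at h
          exact h.trans (dvd_lcm_left _ _)
        simpa [hfi] using hr
    · simpa [hji, show ¬ j + 1 < i by omega] using hfr j (by omega) hj
end

section
/- Assume all the labels m_1, …, m_n and r_1, …, r_{n−1} are nonzero. Suppose that for each 1 ≤ i ≤ n, F^(i) is a spline on the edge-labeled path P_n with F^(i)_s = 0 for all s < i and F^(i)_i = D_i. Then {F^(1), …, F^(n)} is a ℤ-module basis of the module of splines: every spline f can be written uniquely as f = a_1 F^(1) + ⋯ + a_n F^(n) with a_1, …, a_n ∈ ℤ. -/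
theorem pathD_ne_zero {n : ℕ} {m r : ℕ → ℤ} (hm : ∀ j < n, m j ≠ 0)
    (hr : ∀ j, j + 1 < n → r j ≠ 0) {i : ℕ} (hi : i < n) : pathD n m r i ≠ 0 := by
  unfold pathD
  rw [Ne, lcm_eq_zero_iff, lcm_eq_zero_iff, Finset.lcm_eq_zero_iff]
  rintro ((h | h) | ⟨j, hj, h⟩)
  · exact hm i hi h
  · split_ifs at h with h0
    · exact one_ne_zero h
    · exact hr (i - 1) (by omega) h
  · exact hm j (Finset.mem_Ico.1 hj).2 ((gcd_eq_zero_iff _ _).1 h).1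

/-- A common divisor of the edge labels between two vertices divides the difference of the values
of a spline at these vertices. -/
theorem dvd_sub_of_dvd_path_labels {n : ℕ} {r f : ℕ → ℤ}
    (hf : ∀ j, j + 1 < n → r j ∣ f (j + 1) - f j) {d : ℤ} {i j : ℕ} (hij : i ≤ j) (hj : j < n)
    (hd : ∀ t ∈ Finset.Ico i j, d ∣ r t) : d ∣ f j - f i := by
  rw [← Finset.sum_Ico_sub f hij]
  refine Finset.dvd_sum fun t ht => (hd t ht).trans (hf t ?_)
  have := (Finset.mem_Ico.1 ht).2
  omega

/-- The leading value of a flow-up spline at `i` is divisible by `pathD n m r i`. -/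
theorem pathD_dvd_of_flowup {n : ℕ} {m r f : ℕ → ℤ} (hfm : ∀ j < n, m j ∣ f j)
    (hfr : ∀ j, j + 1 < n → r j ∣ f (j + 1) - f j) {i : ℕ} (hi : i < n)
    (h0 : ∀ s < i, f s = 0) : pathD n m r i ∣ f i := by
  refine lcm_dvd (lcm_dvd (hfm i hi) ?_) (Finset.lcm_dvd fun j hj => ?_)
  · split_ifs with h
    · exact one_dvd _
    · have := hfr (i - 1) (by omega)
      rwa [Nat.sub_add_cancel (by omega), h0 (i - 1) (by omega), sub_zero] at this
  · obtain ⟨hij, hjn⟩ := Finset.mem_Ico.1 hj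
    have hsub : gcd (m j) ((Finset.Ico i j).gcd r) ∣ f j - f i :=
      dvd_sub_of_dvd_path_labels hfr (by omega) hjn fun t ht =>
        (gcd_dvd_right _ _).trans (Finset.gcd_dvd ht)
    exact (dvd_sub_right ((gcd_dvd_left _ _).trans (hfm j hjn))).1 hsub

/-- assuming all labels nonzero, any family of flow-up splines
`F i` on the edge-labeled path `Pₙ` with `F i s = 0` for `s < i` and
`F i i = D i` is a ℤ-module basis of the module of splines: every spline is
a unique ℤ-linear combination of the `F i`. -/
theorem path_minimal_flowups_form_basis (n : ℕ) (hn : 1 ≤ n) (m r : ℕ → ℤ)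
    (hm : ∀ j < n, m j ≠ 0) (hrne : ∀ j, j + 1 < n → r j ≠ 0)
    (F : Fin n → ℕ → ℤ)
    (hFspline : ∀ i : Fin n, (∀ j < n, m j ∣ F i j) ∧
      ∀ j, j + 1 < n → r j ∣ F i (j + 1) - F i j)
    (hFflow : ∀ i : Fin n, ∀ s < (i : ℕ), F i s = 0)
    (hFi : ∀ i : Fin n, F i i = pathD n m r i) :
    ∀ f : ℕ → ℤ,
      ((∀ j < n, m j ∣ f j) ∧ ∀ j, j + 1 < n → r j ∣ f (j + 1) - f j) →
      ∃! a : Fin n → ℤ, ∀ j < n, f j = ∑ i, a i * F i j := by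
  rintro f ⟨hfm, hfr⟩
  have hex : ∀ k ≤ n, ∃ a : Fin n → ℤ, ∀ j < k, f j = ∑ i, a i * F i j := by
    intro k
    induction k with
    | zero => exact fun _ => ⟨0, by simp⟩
    | succ k ih =>
      intro hk
      obtain ⟨a, ha⟩ := ih (by omega)
      have hdvd : pathD n m r k ∣ f k - ∑ i, a i * F i k := by
        refine pathD_dvd_of_flowup (f := fun j => f j - ∑ i, a i * F i j)
          (fun j hj => dvd_sub (hfm j hj) (Finset.dvd_sum fun i _ =>
            Dvd.dvd.mul_left ((hFspline i).1 j hj) _))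
          (fun j hj => ?_) hk (fun s hs => sub_eq_zero.2 (ha s hs))
        rw [sub_sub_sub_comm, ← Finset.sum_sub_distrib]
        refine dvd_sub (hfr j hj) (Finset.dvd_sum fun i _ => ?_)
        rw [← mul_sub]
        exact Dvd.dvd.mul_left ((hFspline i).2 j hj) _
      obtain ⟨c, hc⟩ := hdvd
      refine ⟨a + Pi.single ⟨k, hk⟩ c, fun j hj => ?_⟩
      have hsum : ∑ i, (a + Pi.single ⟨k, hk⟩ c : Fin n → ℤ) i * F i j
          = ∑ i, a i * F i j + c * F ⟨k, hk⟩ j := by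
        simp [add_mul, Finset.sum_add_distrib, Pi.single_apply, ite_mul]
      rw [hsum]
      rcases Nat.lt_succ_iff_lt_or_eq.1 hj with hlt | rfl
      · rw [hFflow ⟨k, hk⟩ j hlt, mul_zero, add_zero, ha j hlt]
      · have := hFi ⟨j, hk⟩
        simp only at this
        rw [this]
        linarith
  obtain ⟨a, ha⟩ := hex n le_rfl
  refine ⟨a, ha, fun b hb => ?_⟩
  have heq : ∀ j (hj : j < n), b ⟨j, hj⟩ = a ⟨j, hj⟩ := by
    intro j
    induction j using Nat.strong_induction_on with
    | _ j ih =>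
      intro hj
      have hsum : ∑ i, (b i - a i) * F i j = 0 := by
        simp only [sub_mul, Finset.sum_sub_distrib]
        rw [← hb j hj, ← ha j hj, sub_self]
      rw [Finset.sum_eq_single ⟨j, hj⟩ (fun i _ hij => ?_) (by simp)] at hsum
      · refine sub_eq_zero.1 ((mul_eq_zero.1 hsum).resolve_right ?_)
        exact (hFi ⟨j, hj⟩).trans_ne (pathD_ne_zero hm hrne hj)
      · rcases lt_or_gt_of_ne (fun h => hij (Fin.ext h) : (i : ℕ) ≠ j) with h | h
        · rw [ih i h i.2, sub_self, zero_mul]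
        · rw [hFflow i j h, mul_zero]
  exact funext fun i => heq i i.2
end

section
/- Let h be a spline on (G, m, r). Then for every pair of vertices u, v of G and every trail W in G from u to v, the integer gcd( m(u), g(W) ) divides h(v). -/
/-- `g(W)`: the gcd of the edge labels traversed by a walk `W`
(equal to `0` for a walk with no edges). -/
def walkGcd {V : Type*} {G : SimpleGraph V} (r : V → V → ℤ) {u v : V}
    (W : G.Walk u v) : ℤ :=
  (W.darts.map (fun d => r d.toProd.1 d.toProd.2)).foldr gcd 0

/-- The gcd of the edge labels along a walk divides the difference of the values at its ends,
provided each edge label divides the difference across that edge. -/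
theorem walkGcd_dvd_sub {V : Type*} {G : SimpleGraph V} {r : V → V → ℤ} {h : V → ℤ}
    (hr : ∀ u w, G.Adj u w → r u w ∣ h u - h w) {u v : V} (W : G.Walk u v) :
    walkGcd r W ∣ h u - h v := by
  induction W with
  | nil => simp
  | @cons a b c hab p ih =>
    have hcons : walkGcd r (SimpleGraph.Walk.cons hab p) = gcd (r a b) (walkGcd r p) := rfl
    rw [hcons, ← sub_add_sub_cancel (h a) (h b) (h c)]
    exact dvd_add ((gcd_dvd_left _ _).trans (hr a b hab)) ((gcd_dvd_right _ _).trans ih)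

/-- if `h` is a spline on `(G, m, r)`, then for all vertices
`u, v` and every trail `W` from `u` to `v`, `gcd (m u) (g W)` divides `h v`. -/
theorem trail_gcd_dvd_spline_value {n : ℕ} (G : SimpleGraph (Fin n))
    (m : Fin n → ℤ) (r : Fin n → Fin n → ℤ) (hr : ∀ u w, r u w = r w u)
    (h : Fin n → ℤ)
    (hspline : (∀ v, m v ∣ h v) ∧ ∀ u w, G.Adj u w → r u w ∣ h u - h w)
    (u v : Fin n) (W : G.Walk u v) (hW : W.IsTrail) :
    gcd (m u) (walkGcd r W) ∣ h v := by
  have hdiff := (gcd_dvd_right (m u) _).trans (walkGcd_dvd_sub hspline.2 W)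
  exact (dvd_sub_right ((gcd_dvd_left _ _).trans (hspline.1 u))).mp hdiff
end

section
/- Fix 2 ≤ i ≤ n. Let G' be the induced subgraph of G on the vertices {v_i, …, v_n}, with the same edge labels r, and with new vertex labels m'(v_l) = lcm( m(v_l), lcm of the labels r(v_l v_s) over all edges v_l v_s of G with s < i ) for each l ≥ i. Then for any tuple (f_i, …, f_n) ∈ ℤ^{n−i+1}, the vertex labeling of G given by f(v_l) = f_l for l ≥ i and f(v_s) = 0 for s < i is a spline on (G, m, r) if and only if (f_i, …, f_n) is a spline on (G', m', r). -/
/-- zero vertex reduction. Fix `i` (with at least one vertex below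
it). Let `G'` be the induced subgraph on the vertices `v_l`, `l ≥ i`, with the
same edge labels `r` and new vertex labels
`m' l = lcm (m l) (lcm of r (v_l v_s) over edges v_l v_s with s < i)`.
Then for any tuple `(f_i, …, f_{n-1})`, its extension by zero below `i` is a
spline on `(G, m, r)` iff the tuple is a spline on `(G', m', r)`. -/
theorem zero_vertex_reduction {n : ℕ} (G : SimpleGraph (Fin n))
    [DecidableRel G.Adj]
    (m : Fin n → ℤ) (r : Fin n → Fin n → ℤ) (hr : ∀ u w, r u w = r w u)
    (i : Fin n) (hi : 1 ≤ (i : ℕ)) (f : Fin n → ℤ) :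
    let m' : Fin n → ℤ := fun l =>
      lcm (m l) ((Finset.univ.filter (fun s => G.Adj l s ∧ s < i)).lcm (r l))
    let g : Fin n → ℤ := fun v => if v < i then 0 else f v
    ((∀ v, m v ∣ g v) ∧ ∀ u w, G.Adj u w → r u w ∣ g u - g w)
    ↔
    ((∀ l, i ≤ l → m' l ∣ f l) ∧
      ∀ l s, i ≤ l → i ≤ s → G.Adj l s → r l s ∣ f l - f s) := by
  intro m' g
  have g_lt {v : Fin n} (hv : v < i) : g v = 0 := if_pos hv
  have g_ge {v : Fin n} (hv : i ≤ v) : g v = f v := if_neg hv.not_gt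
  have m'_dvd (l : Fin n) (x : ℤ) :
      m' l ∣ x ↔ m l ∣ x ∧ ∀ s, G.Adj l s → s < i → r l s ∣ x := by
    simp only [m', lcm_dvd_iff, Finset.lcm_dvd_iff, Finset.mem_filter, Finset.mem_univ,
      true_and, and_imp]
  constructor
  · rintro ⟨hm, he⟩
    refine ⟨fun l hl => (m'_dvd l _).2 ⟨?_, fun s hs hsi => ?_⟩, fun l s hl hs h => ?_⟩
    · simpa only [g_ge hl] using hm l
    · simpa only [g_ge hl, g_lt hsi, sub_zero] using he l s hs
    · simpa only [g_ge hl, g_ge hs] using he l s h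
  · rintro ⟨hm, he⟩
    refine ⟨fun v => ?_, fun u w h => ?_⟩
    · rcases lt_or_ge v i with hv | hv
      · simp only [g_lt hv, dvd_zero]
      · simpa only [g_ge hv] using ((m'_dvd v _).1 (hm v hv)).1
    · rcases lt_or_ge u i with hu | hu <;> rcases lt_or_ge w i with hw | hw
      · simp only [g_lt hu, g_lt hw, sub_zero, dvd_zero]
      · rw [g_lt hu, g_ge hw, zero_sub, dvd_neg, hr]
        exact ((m'_dvd w _).1 (hm w hw)).2 u h.symm hu
      · rw [g_ge hu, g_lt hw, sub_zero]
        exact ((m'_dvd u _).1 (hm u hu)).2 w h hw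
      · rw [g_ge hu, g_ge hw]
        exact he u w hu hw h
end

section
/- For all 1 ≤ i < t ≤ n, one has the containment of ideals of ℤ: K(v_i) ⊆ I(v_t, v_i) + K(v_t). Equivalently, the nonnegative generator of K(v_i) is a multiple of gcd( lcm over trails W from v_t to v_i of g(W), the nonnegative generator of K(v_t) ). -/
/-- `I(u, v)`: the intersection of the ideals `g(W)ℤ` over all trails `W`
from `u` to `v` (equal to `ℤ` when there is no such trail). -/
def trailIdeal {V : Type*} (G : SimpleGraph V) (r : V → V → ℤ) (u v : V) :
    Ideal ℤ :=
  ⨅ (W : G.Walk u v) (_ : W.IsTrail), Ideal.span {walkGcd r W}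

/-- `K(v) = m(v)ℤ ∩ ⋂_{u ≠ v} (m(u)ℤ + I(u, v))`. -/
def vertexIdeal {V : Type*} (G : SimpleGraph V) (m : V → ℤ)
    (r : V → V → ℤ) (v : V) : Ideal ℤ :=
  Ideal.span {m v} ⊓ ⨅ (u : V) (_ : u ≠ v), (Ideal.span {m u} ⊔ trailIdeal G r u v)

theorem Ideal.sup_inf_sup_le_int (I J K : Ideal ℤ) : (I ⊔ J) ⊓ (I ⊔ K) ≤ I ⊔ J ⊓ K := by
  obtain ⟨b, rfl⟩ := (IsPrincipalIdealRing.principal J).principal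
  obtain ⟨c, rfl⟩ := (IsPrincipalIdealRing.principal K).principal
  rintro x ⟨hb, hc⟩
  obtain ⟨y, hy, _, hz, rfl⟩ := Submodule.mem_sup.1 hb
  obtain ⟨y', hy', _, hz', h⟩ := Submodule.mem_sup.1 hc
  obtain ⟨q, rfl⟩ := Ideal.mem_span_singleton'.1 hz
  obtain ⟨s, rfl⟩ := Ideal.mem_span_singleton'.1 hz'
  obtain ⟨b', c', d, u, v, rfl, rfl, huv⟩ :
      ∃ b' c' d u v : ℤ, b = b' * d ∧ c = c' * d ∧ u * b' + v * c' = 1 := by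
    rcases Nat.eq_zero_or_pos (Int.gcd b c) with h0 | h0
    · obtain ⟨rfl, rfl⟩ := Int.gcd_eq_zero_iff.1 h0
      exact ⟨1, 0, 0, 1, 0, by simp⟩
    · obtain ⟨b', c', hcop, h1, h2⟩ := Int.exists_gcd_one h0
      obtain ⟨u, v, huv⟩ := Int.isCoprime_iff_gcd_eq_one.2 hcop
      exact ⟨b', c', _, u, v, h1, h2, huv⟩
  refine Submodule.mem_sup.2 ⟨u * b' * y' + v * c' * y,
    I.add_mem (I.mul_mem_left _ hy') (I.mul_mem_left _ hy),
    (u * s + v * q) * (b' * c' * d), ⟨?_, ?_⟩, ?_⟩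
  · exact Ideal.mem_span_singleton'.2 ⟨(u * s + v * q) * c', by ring⟩
  · exact Ideal.mem_span_singleton'.2 ⟨(u * s + v * q) * b', by ring⟩
  · linear_combination u * b' * h + (y + q * (b' * d)) * huv

theorem Ideal.iInf_sup_le_int {ι : Type*} [Finite ι] (I : Ideal ℤ) (J : ι → Ideal ℤ) :
    ⨅ i, (I ⊔ J i) ≤ I ⊔ ⨅ i, J i := by
  classical
  have := Fintype.ofFinite ι
  suffices h : ∀ s : Finset ι, s.inf (fun i => I ⊔ J i) ≤ I ⊔ s.inf J by
    simpa [Finset.inf_univ_eq_iInf] using h Finset.univ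
  intro s
  induction s using Finset.induction_on with
  | empty => simp
  | insert a s ha ih =>
    rw [Finset.inf_insert, Finset.inf_insert]
    exact (inf_le_inf_left _ ih).trans (Ideal.sup_inf_sup_le_int _ _ _)

section WalkGcd

variable {V : Type*} {G : SimpleGraph V} (r : V → V → ℤ)

theorem dvd_walkGcd_iff {u v : V} (W : G.Walk u v) (k : ℤ) :
    k ∣ walkGcd r W ↔ ∀ d ∈ W.darts, k ∣ r d.toProd.1 d.toProd.2 := by
  unfold walkGcd
  induction W.darts with
  | nil => simp
  | cons d l ih => simp [dvd_gcd_iff, ih]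

theorem walkGcd_dvd_of_darts_subset {u v u' v' : V} {W : G.Walk u v} {W' : G.Walk u' v'}
    (h : W'.darts ⊆ W.darts) : walkGcd r W ∣ walkGcd r W' :=
  (dvd_walkGcd_iff r W' _).2 fun d hd => (dvd_walkGcd_iff r W _).1 dvd_rfl d (h hd)

theorem trailIdeal_le_span_walkGcd {u v : V} (W : G.Walk u v) :
    trailIdeal G r u v ≤ Ideal.span {walkGcd r W} := by
  classical
  exact (iInf₂_le W.bypass W.bypass_isPath.isTrail).trans <|
    Ideal.span_singleton_le_span_singleton.2 <|
      walkGcd_dvd_of_darts_subset r W.darts_bypass_subset_darts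

theorem trailIdeal_eq_iInf_path (u v : V) :
    trailIdeal G r u v = ⨅ P : G.Path u v, Ideal.span {walkGcd r P.1} := by
  classical
  refine le_antisymm (le_iInf fun P => trailIdeal_le_span_walkGcd r P.1) ?_
  exact le_iInf₂ fun W _ => (iInf_le _ W.toPath).trans <|
    Ideal.span_singleton_le_span_singleton.2 <|
      walkGcd_dvd_of_darts_subset r W.darts_bypass_subset_darts

theorem trailIdeal_le_sup_span_walkGcd {u v w : V} (P : G.Walk u v) (Q : G.Walk v w) :
    trailIdeal G r u w ≤ Ideal.span {walkGcd r P} ⊔ Ideal.span {walkGcd r Q} := by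
  refine (trailIdeal_le_span_walkGcd r (P.append Q)).trans ?_
  rw [← Ideal.span_union, Set.singleton_union, ← span_gcd,
    Ideal.span_singleton_le_span_singleton, dvd_walkGcd_iff]
  intro d hd
  rw [SimpleGraph.Walk.darts_append, List.mem_append] at hd
  rcases hd with hd | hd
  · exact (gcd_dvd_left _ _).trans ((dvd_walkGcd_iff r P _).1 dvd_rfl d hd)
  · exact (gcd_dvd_right _ _).trans ((dvd_walkGcd_iff r Q _).1 dvd_rfl d hd)

theorem trailIdeal_le_sup [Finite V] (u v w : V) :
    trailIdeal G r u w ≤ trailIdeal G r u v ⊔ trailIdeal G r v w := by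
  classical
  have := Fintype.ofFinite V
  rw [trailIdeal_eq_iInf_path r v w]
  refine le_trans (le_iInf fun Q => ?_) (Ideal.iInf_sup_le_int _ _)
  rw [trailIdeal_eq_iInf_path r u v, sup_comm]
  refine le_trans (le_iInf fun P => ?_) (Ideal.iInf_sup_le_int _ _)
  rw [sup_comm]
  exact trailIdeal_le_sup_span_walkGcd r P.1 Q.1

end WalkGcd

/-- for all `i < t`, `K(v_i) ⊆ I(v_t, v_i) + K(v_t)`. -/
theorem vertexIdeal_le {n : ℕ} (G : SimpleGraph (Fin n))
    (m : Fin n → ℤ) (r : Fin n → Fin n → ℤ) (hr : ∀ u w, r u w = r w u)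
    (i t : Fin n) (hit : i < t) :
    vertexIdeal G m r i ≤ trailIdeal G r t i ⊔ vertexIdeal G m r t := by
  have hK : ∀ u, u ≠ i → vertexIdeal G m r i ≤ Ideal.span {m u} ⊔ trailIdeal G r u i :=
    fun u hu => inf_le_right.trans (iInf₂_le u hu)
  have ht : vertexIdeal G m r i ≤ trailIdeal G r t i ⊔ Ideal.span {m t} :=
    (hK t hit.ne').trans (sup_comm _ _).le
  refine le_trans (le_inf ht ?_) (Ideal.sup_inf_sup_le_int _ _ _)
  rw [iInf_subtype']
  refine le_trans (le_iInf fun u => ?_) (Ideal.iInf_sup_le_int _ _)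
  rcases eq_or_ne u.1 i with hu | hu
  · rw [hu]
    exact inf_le_left.trans (le_sup_left.trans le_sup_right)
  · refine (hK u hu).trans (sup_le (le_sup_left.trans le_sup_right) ?_)
    exact (trailIdeal_le_sup r u.1 t i).trans
      (sup_le (le_sup_right.trans le_sup_right) le_sup_left)
end

section
/- Assume m(v) ≠ 0 for every vertex v and r(e) ≠ 0 for every edge e of G. Then for each 1 ≤ i ≤ n there exists a spline F^(i) on (G, m, r) such that F^(i)(v_s) = 0 for all s < i, F^(i)(v_i) ≠ 0, and for every spline A on (G, m, r) with A(v_s) = 0 for all s < i, the integer F^(i)(v_i) divides A(v_i) (a minimal flow-up class at each index exists). -/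
/-- The splines on `(G, m, r)` that vanish at every vertex below `i`. -/
def flowUpSplines {V : Type*} [LT V] (G : SimpleGraph V) (m : V → ℤ) (r : V → V → ℤ) (i : V) :
    Submodule ℤ (V → ℤ) where
  carrier := {F | ((∀ v, m v ∣ F v) ∧ ∀ u w, G.Adj u w → r u w ∣ F u - F w) ∧ ∀ s, s < i → F s = 0}
  zero_mem' := by simp
  add_mem' := by
    rintro F F' ⟨⟨hv, he⟩, h₀⟩ ⟨⟨hv', he'⟩, h₀'⟩
    refine ⟨⟨fun v => dvd_add (hv v) (hv' v), fun u w h => ?_⟩, fun s hs => ?_⟩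
    · rw [Pi.add_apply, Pi.add_apply, add_sub_add_comm]
      exact dvd_add (he u w h) (he' u w h)
    · simp [h₀ s hs, h₀' s hs]
  smul_mem' := by
    rintro c F ⟨⟨hv, he⟩, h₀⟩
    refine ⟨⟨fun v => (hv v).mul_left c, fun u w h => ?_⟩, fun s hs => ?_⟩
    · rw [Pi.smul_apply, Pi.smul_apply, ← smul_sub]
      exact (he u w h).mul_left c
    · simp [h₀ s hs]

/-- On a finite graph with nonzero labels, some spline vanishing below `i` is nonzero at `i`. -/
theorem exists_mem_flowUpSplines_ne_zero {V : Type*} [Fintype V] [Preorder V]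
    (G : SimpleGraph V) (m : V → ℤ) (r : V → V → ℤ)
    (hm : ∀ v, m v ≠ 0) (hre : ∀ u w, G.Adj u w → r u w ≠ 0) (i : V) :
    ∃ F ∈ flowUpSplines G m r i, F i ≠ 0 := by
  classical
  let e : V × V → ℤ := fun p => if G.Adj p.1 p.2 then r p.1 p.2 else 1
  have he_ne : ∏ p, e p ≠ 0 := by
    refine Finset.prod_ne_zero_iff.mpr fun p _ => ?_
    by_cases h : G.Adj p.1 p.2
    · simpa [e, h] using hre _ _ h
    · simp [e, h]
  have he_dvd : ∀ u w, G.Adj u w → r u w ∣ ∏ p, e p := fun u w h => by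
    simpa [e, h] using Finset.dvd_prod_of_mem e (Finset.mem_univ (u, w))
  have hL : ∀ x : V, ∀ d : ℤ, d ∣ (∏ v, m v) * ∏ p, e p →
      d ∣ (Pi.single i ((∏ v, m v) * ∏ p, e p) : V → ℤ) x := fun x d hd => by
    rw [Pi.single_apply]
    split_ifs
    exacts [hd, dvd_zero d]
  refine ⟨Pi.single i ((∏ v, m v) * ∏ p, e p), ⟨⟨fun v => ?_, fun u w h => ?_⟩, fun s hs => ?_⟩, ?_⟩
  · exact hL v _ ((Finset.dvd_prod_of_mem m (Finset.mem_univ v)).mul_right _)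
  · exact dvd_sub (hL u _ ((he_dvd u w h).mul_left _)) (hL w _ ((he_dvd u w h).mul_left _))
  · exact Pi.single_eq_of_ne hs.ne _
  · rw [Pi.single_eq_same]
    exact mul_ne_zero (Finset.prod_ne_zero_iff.mpr fun v _ => hm v) he_ne


/-- if all vertex labels and all edge labels (of actual edges)
are nonzero, then for each index `i` there exists a minimal flow-up spline:
a spline `F` vanishing below `i`, nonzero at `i`, whose value at `i`
divides the value at `i` of every spline vanishing below `i`. -/
theorem minimal_flowup_exists {n : ℕ} (G : SimpleGraph (Fin n))
    (m : Fin n → ℤ) (r : Fin n → Fin n → ℤ) (hr : ∀ u w, r u w = r w u)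
    (hm : ∀ v, m v ≠ 0) (hre : ∀ u w, G.Adj u w → r u w ≠ 0) :
    ∀ i : Fin n, ∃ F : Fin n → ℤ,
      ((∀ v, m v ∣ F v) ∧ ∀ u w, G.Adj u w → r u w ∣ F u - F w) ∧
      (∀ s, s < i → F s = 0) ∧ F i ≠ 0 ∧
      ∀ A : Fin n → ℤ,
        ((∀ v, m v ∣ A v) ∧ ∀ u w, G.Adj u w → r u w ∣ A u - A w) →
        (∀ s, s < i → A s = 0) → F i ∣ A i := by
  intro i
  let I : Ideal ℤ := (flowUpSplines G m r i).map (LinearMap.proj i)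
  have hdvd : ∀ A ∈ flowUpSplines G m r i, Submodule.IsPrincipal.generator I ∣ A i := fun A hA =>
    (Submodule.IsPrincipal.mem_iff_generator_dvd I).mp (Submodule.mem_map_of_mem hA)
  obtain ⟨F, hF, hFi⟩ := Submodule.mem_map.mp (Submodule.IsPrincipal.generator_mem I)
  replace hFi : F i = Submodule.IsPrincipal.generator I := hFi
  obtain ⟨L, hL, hLi⟩ := exists_mem_flowUpSplines_ne_zero G m r hm hre i
  refine ⟨F, hF.1, hF.2, ?_, fun A hA hA₀ => ?_⟩
  · rw [hFi]
    exact ne_zero_of_dvd_ne_zero hLi (hdvd L hL)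
  · rw [hFi]
    exact hdvd A ⟨hA, hA₀⟩
end

section
/- Assume m(v) ≠ 0 for every vertex v and r(e) ≠ 0 for every edge e of G. Suppose that for each 1 ≤ i ≤ n, F^(i) is a spline on (G, m, r) with F^(i)(v_s) = 0 for all s < i, F^(i)(v_i) ≠ 0, and such that F^(i)(v_i) divides A(v_i) for every spline A with A(v_s) = 0 for all s < i. Then {F^(1), …, F^(n)} is a ℤ-module basis of the module of splines on (G, m, r): every spline f can be written uniquely as f = a_1 F^(1) + ⋯ + a_n F^(n) with a_1, …, a_n ∈ ℤ. -/
/-- The ℤ-submodule of splines on a graph with vertex labels `m` and edge labels `r`. -/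
def splineSubmodule {V : Type*} (G : SimpleGraph V) (m : V → ℤ) (r : V → V → ℤ) :
    Submodule ℤ (V → ℤ) where
  carrier := {f | (∀ v, m v ∣ f v) ∧ ∀ u w, G.Adj u w → r u w ∣ f u - f w}
  zero_mem' := by simp
  add_mem' := by
    rintro f g ⟨hf, hf'⟩ ⟨hg, hg'⟩
    refine ⟨fun v => dvd_add (hf v) (hg v), fun u w h => ?_⟩
    simpa only [Pi.add_apply, add_sub_add_comm] using dvd_add (hf' u w h) (hg' u w h)
  smul_mem' := by
    rintro c f ⟨hf, hf'⟩
    refine ⟨fun v => Dvd.dvd.mul_left (hf v) c, fun u w h => ?_⟩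
    simpa only [Pi.smul_apply, smul_eq_mul, ← mul_sub] using Dvd.dvd.mul_left (hf' u w h) c

/-- A triangular family with nonzero diagonal admits only the trivial relation. -/
theorem eq_zero_of_triangular_sum_eq_zero {R : Type*} [CommRing R] [IsDomain R] {n : ℕ}
    {F : Fin n → Fin n → R} (hF : ∀ i s, s < i → F i s = 0) (hne : ∀ i, F i i ≠ 0)
    {d : Fin n → R} (hd : ∀ v, ∑ j, d j * F j v = 0) (i : Fin n) : d i = 0 := by
  induction i using WellFoundedLT.induction with
  | ind i ih =>
    have h := hd i
    rw [Finset.sum_eq_single i] at h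
    · exact (mul_eq_zero.mp h).resolve_right (hne i)
    · intro j _ hj
      rcases lt_or_gt_of_ne hj with hlt | hgt
      · rw [ih j hlt, zero_mul]
      · rw [hF j i hgt, mul_zero]
    · simp

/-- A triangular family in a submodule `S` whose diagonal entries divide the leading entries of
elements of `S` spans `S`. -/
theorem exists_eq_sum_of_triangular_of_dvd {R : Type*} [CommRing R] {n : ℕ}
    {S : Submodule R (Fin n → R)} {F : Fin n → Fin n → R} (hFS : ∀ i, F i ∈ S)
    (hF : ∀ i s, s < i → F i s = 0)
    (hmin : ∀ i, ∀ A ∈ S, (∀ s, s < i → A s = 0) → F i i ∣ A i)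
    {f : Fin n → R} (hf : f ∈ S) : ∃ a : Fin n → R, f = ∑ j, a j • F j := by
  suffices h : ∀ k ≤ n, ∃ a : Fin n → R,
      ∀ v : Fin n, (v : ℕ) < k → (f - ∑ j, a j • F j) v = 0 by
    obtain ⟨a, ha⟩ := h n le_rfl
    exact ⟨a, sub_eq_zero.mp (funext fun v => ha v v.isLt)⟩
  intro k
  induction k with
  | zero => exact fun _ => ⟨0, fun v hv => absurd hv (Nat.not_lt_zero _)⟩
  | succ k ih =>
    intro hk
    obtain ⟨a, ha⟩ := ih (Nat.le_of_succ_le hk)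
    let i : Fin n := ⟨k, hk⟩
    obtain ⟨c, hc⟩ := hmin i (f - ∑ j, a j • F j)
      (S.sub_mem hf (S.sum_mem fun j _ => S.smul_mem _ (hFS j))) fun s hs => ha s hs
    refine ⟨a + Pi.single i c, fun v hv => ?_⟩
    have hsum : ∑ j, (a + Pi.single i c : Fin n → R) j • F j = ∑ j, a j • F j + c • F i := by
      simp [add_smul, Finset.sum_add_distrib, Pi.single_apply, ite_smul]
    rw [hsum, ← sub_sub, Pi.sub_apply, Pi.smul_apply, smul_eq_mul]
    rcases Nat.lt_succ_iff_lt_or_eq.mp hv with hlt | heq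
    · rw [ha v hlt, hF i v hlt, mul_zero, sub_zero]
    · obtain rfl : v = i := Fin.ext heq
      rw [hc, mul_comm, sub_self]


/-- if all vertex labels and all edge labels (of actual edges)
are nonzero, then any family of minimal flow-up splines `F i` (vanishing below
`i`, nonzero at `i`, with `F i i` dividing `A i` for every spline `A` vanishing
below `i`) is a ℤ-module basis of the module of splines: every spline is a
unique ℤ-linear combination of the `F i`. -/
theorem minimal_flowups_form_basis {n : ℕ} (G : SimpleGraph (Fin n))
    (m : Fin n → ℤ) (r : Fin n → Fin n → ℤ) (hr : ∀ u w, r u w = r w u)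
    (hm : ∀ v, m v ≠ 0) (hre : ∀ u w, G.Adj u w → r u w ≠ 0)
    (F : Fin n → Fin n → ℤ)
    (hFspline : ∀ i, (∀ v, m v ∣ F i v) ∧
      ∀ u w, G.Adj u w → r u w ∣ F i u - F i w)
    (hFflow : ∀ i s, s < i → F i s = 0)
    (hFne : ∀ i, F i i ≠ 0)
    (hFmin : ∀ (i : Fin n) (A : Fin n → ℤ),
      ((∀ v, m v ∣ A v) ∧ ∀ u w, G.Adj u w → r u w ∣ A u - A w) →
      (∀ s, s < i → A s = 0) → F i i ∣ A i) :
    ∀ f : Fin n → ℤ,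
      ((∀ v, m v ∣ f v) ∧ ∀ u w, G.Adj u w → r u w ∣ f u - f w) →
      ∃! a : Fin n → ℤ, ∀ v, f v = ∑ j, a j * F j v := by
  intro f hf
  obtain ⟨a, ha⟩ := exists_eq_sum_of_triangular_of_dvd (S := splineSubmodule G m r)
    hFspline hFflow hFmin hf
  have ha' : ∀ v, f v = ∑ j, a j * F j v := fun v => by
    simpa [Finset.sum_apply] using congrFun ha v
  refine ⟨a, ha', fun b hb => funext fun i => sub_eq_zero.mp ?_⟩
  refine eq_zero_of_triangular_sum_eq_zero hFflow hFne (d := fun j => b j - a j) (fun v => ?_) i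
  simp only [sub_mul, Finset.sum_sub_distrib]
  rw [← hb v, ← ha' v, sub_self]
end

section
/- For each 1 ≤ i ≤ n there exists a spline F^(i) = (f_1, …, f_n) on the edge-labeled cycle C_n such that f_s = 0 for all s < i and f_i = c_i; moreover, for every spline A on C_n with A_s = 0 for all s < i, the integer c_i divides A_i. -/
/-- `c i` (0-indexed) for the cycle `Cₙ` with vertex labels `m 0, …, m (n-1)`,
path edge labels `r 0, …, r (n-2)` (edge `v_j v_{j+1}` labeled `r j`) and
closing edge `v_0 v_{n-1}` labeled `r (n-1)`.
For `i = 0` it is the lcm of `m 0`, the `gcd (m j) (gcd (r 0, …, r (j-1)))`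
for `1 ≤ j ≤ n-1`, and the `gcd (m j) (gcd (r j, …, r (n-1)))` for
`1 ≤ j ≤ n-1`. For `i ≥ 1` it is the lcm of `m i`, `r (i-1)`, the
`gcd (m j) (gcd (r i, …, r (j-1)))` for `i+1 ≤ j ≤ n-1`, and
`gcd (r i, …, r (n-1))`. -/
def cycleC (n : ℕ) (m r : ℕ → ℤ) (i : ℕ) : ℤ :=
  if i = 0 then
    lcm (m 0) (lcm
      ((Finset.Ico 1 n).lcm (fun j => gcd (m j) ((Finset.Ico 0 j).gcd r)))
      ((Finset.Ico 1 n).lcm (fun j => gcd (m j) ((Finset.Ico j n).gcd r))))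
  else
    lcm (lcm (m i) (r (i - 1)))
      (lcm ((Finset.Ico (i + 1) n).lcm
          (fun j => gcd (m j) ((Finset.Ico i j).gcd r)))
        ((Finset.Ico i n).gcd r))

theorem gcd_lcm_dvd_of_gcd_dvd {a b c z : ℤ} (ha : gcd a c ∣ z) (hb : gcd b c ∣ z) :
    gcd (lcm a b) c ∣ z := by
  obtain ⟨a', b', ha', hb', hu⟩ := extract_gcd a b
  obtain ⟨u, v, huv⟩ := (gcd_dvd_iff_exists a' b').1 (hu.dvd : gcd a' b' ∣ 1)
  obtain ⟨x, x', hx⟩ := (gcd_dvd_iff_exists a c).1 ha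
  obtain ⟨y, y', hy⟩ := (gcd_dvd_iff_exists b c).1 hb
  set d := gcd a b
  have hl : lcm a b ∣ d * a' * b' :=
    lcm_dvd ⟨b', by rw [← ha']⟩ ⟨a', by rw [mul_right_comm, ← hb']⟩
  have hz : z = d * a' * b' * (u * y + v * x) + c * (a' * u * y' + b' * v * x') := by
    linear_combination z * huv + a' * u * hy + b' * v * hx + a' * u * y * hb' + b' * v * x * ha'
  rw [hz]
  exact dvd_add (((gcd_dvd_left _ _).trans hl).mul_right _) ((gcd_dvd_right _ _).mul_right _)

theorem gcd_finset_lcm_dvd_of_gcd_dvd {ι : Type*} {s : Finset ι} {f : ι → ℤ} {a z : ℤ}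
    (h : ∀ k ∈ s, gcd (f k) a ∣ z) : gcd (s.lcm f) a ∣ z := by
  classical
  induction s using Finset.induction_on with
  | empty => simp
  | insert k s _ ih =>
    rw [Finset.lcm_insert]
    exact gcd_lcm_dvd_of_gcd_dvd (h k (Finset.mem_insert_self k s))
      (ih fun l hl => h l (Finset.mem_insert_of_mem hl))

theorem exists_modEq_of_gcd_dvd_sub {a b y z : ℤ} (h : gcd a b ∣ y - z) :
    ∃ x, a ∣ x - y ∧ b ∣ x - z := by
  obtain ⟨u, v, huv⟩ := (gcd_dvd_iff_exists a b).1 h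
  exact ⟨y - a * u, ⟨-u, by ring⟩, ⟨v, by linear_combination huv⟩⟩

/-- Three pairwise compatible congruences have a common solution. -/
theorem exists_modEq_three {a b c x y z : ℤ} (hab : gcd a b ∣ x - y) (hac : gcd a c ∣ x - z)
    (hbc : gcd b c ∣ y - z) : ∃ w, a ∣ w - x ∧ b ∣ w - y ∧ c ∣ w - z := by
  obtain ⟨w₀, hwa, hwb⟩ := exists_modEq_of_gcd_dvd_sub hab
  have h : gcd (lcm a b) c ∣ w₀ - z := by
    apply gcd_lcm_dvd_of_gcd_dvd
    · simpa using dvd_add ((gcd_dvd_left a c).trans hwa) hac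
    · simpa using dvd_add ((gcd_dvd_left b c).trans hwb) hbc
  obtain ⟨w, hw, hwc⟩ := exists_modEq_of_gcd_dvd_sub h
  refine ⟨w, ?_, ?_, hwc⟩
  · simpa using dvd_add ((dvd_lcm_left a b).trans hw) hwa
  · simpa using dvd_add ((dvd_lcm_right a b).trans hw) hwb

theorem finset_gcd_Ico_eq_gcd {r : ℕ → ℤ} {j k : ℕ} (h : j < k) :
    (Finset.Ico j k).gcd r = gcd (r j) ((Finset.Ico (j + 1) k).gcd r) := by
  rw [← Finset.insert_Ico_add_one_left_eq_Ico h, Finset.gcd_insert]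

/-- Along a path whose consecutive values are congruent modulo the edge labels, the gcd of the
labels divides the difference of the end values. -/
theorem gcd_Ico_dvd_sub {r A : ℕ → ℤ} {j k : ℕ} (hjk : j ≤ k)
    (h : ∀ l, j ≤ l → l < k → r l ∣ A (l + 1) - A l) :
    (Finset.Ico j k).gcd r ∣ A k - A j := by
  rw [← Finset.sum_Ico_sub A hjk]
  refine Finset.dvd_sum fun l hl => (Finset.gcd_dvd hl).trans ?_
  exact h l (Finset.mem_Ico.1 hl).1 (Finset.mem_Ico.1 hl).2

/-- A value `y` at vertex `j` extends along the path `j, …, n - 1` to a spline ending congruent to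
`t` modulo `r (n - 1)` as soon as all pairwise congruence obstructions vanish. -/
theorem exists_path_spline {n : ℕ} {m r : ℕ → ℤ} {t : ℤ} {j : ℕ} (hj : j < n) {y : ℤ}
    (hy : ∀ k, j ≤ k → k < n → gcd (m k) ((Finset.Ico j k).gcd r) ∣ y)
    (hyt : (Finset.Ico j n).gcd r ∣ y - t)
    (ht : ∀ k, j < k → k < n → gcd (m k) ((Finset.Ico k n).gcd r) ∣ t) :
    ∃ f : ℕ → ℤ, f j = y ∧ (∀ k, j ≤ k → k < n → m k ∣ f k) ∧
      (∀ k, j ≤ k → k + 1 < n → r k ∣ f (k + 1) - f k) ∧ r (n - 1) ∣ f (n - 1) - t := by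
  obtain ⟨d, hd⟩ := Nat.exists_eq_add_of_lt hj
  induction d generalizing j y with
  | zero =>
    subst hd
    refine ⟨fun _ => y, rfl, fun k hk hkn => ?_, fun k hk hkn => by omega, ?_⟩
    · obtain rfl : k = j := by omega
      simpa using hy k le_rfl hkn
    · simpa using hyt
  | succ d ih =>
    obtain ⟨x, hxD, hxG, hxr⟩ : ∃ x,
        (Finset.Ico (j + 1) n).lcm (fun k => gcd (m k) ((Finset.Ico (j + 1) k).gcd r)) ∣ x - 0 ∧
        (Finset.Ico (j + 1) n).gcd r ∣ x - t ∧ r j ∣ x - y := by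
      apply exists_modEq_three
      · rw [zero_sub, dvd_neg]
        refine gcd_finset_lcm_dvd_of_gcd_dvd fun k hk => ?_
        rw [Finset.mem_Ico] at hk
        refine dvd_trans (dvd_gcd ?_ ?_) (ht k (by omega) hk.2)
        · exact (gcd_dvd_left _ _).trans (gcd_dvd_left _ _)
        · exact (gcd_dvd_right _ _).trans
            (Finset.gcd_mono (Finset.Ico_subset_Ico_left hk.1))
      · rw [zero_sub, dvd_neg]
        refine gcd_finset_lcm_dvd_of_gcd_dvd fun k hk => ?_
        rw [Finset.mem_Ico] at hk
        have h := hy k (by omega) hk.2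
        rwa [finset_gcd_Ico_eq_gcd (by omega), gcd_comm (r j), ← gcd_assoc] at h
      · rwa [finset_gcd_Ico_eq_gcd hj, gcd_comm, dvd_sub_comm] at hyt
    rw [sub_zero] at hxD
    obtain ⟨f, hf, hfm, hfr, hft⟩ := ih (j := j + 1) (y := x) (by omega)
      (fun k hk hkn => (Finset.dvd_lcm (Finset.mem_Ico.2 ⟨hk, hkn⟩)).trans hxD) hxG
      (fun k hk hkn => ht k (by omega) hkn) (by omega)
    refine ⟨Function.update f j y, by simp, fun k hk hkn => ?_, fun k hk hkn => ?_, ?_⟩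
    · rcases hk.eq_or_lt with rfl | hk
      · simpa using hy j le_rfl hkn
      · rw [Function.update_of_ne hk.ne']
        exact hfm k hk hkn
    · rw [Function.update_of_ne (by omega : k + 1 ≠ j)]
      rcases hk.eq_or_lt with rfl | hk
      · simpa [hf] using hxr
      · rw [Function.update_of_ne hk.ne']
        exact hfr k hk hkn
    · rwa [Function.update_of_ne (by omega)]

theorem cycleC_zero_dvd_iff {n : ℕ} {m r : ℕ → ℤ} {z : ℤ} :
    cycleC n m r 0 ∣ z ↔ m 0 ∣ z ∧
      (∀ k, 1 ≤ k → k < n → gcd (m k) ((Finset.Ico 0 k).gcd r) ∣ z) ∧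
      ∀ k, 1 ≤ k → k < n → gcd (m k) ((Finset.Ico k n).gcd r) ∣ z := by
  simp only [cycleC, if_true, lcm_dvd_iff, Finset.lcm_dvd_iff, Finset.mem_Ico, and_imp]

theorem cycleC_dvd_iff {n : ℕ} {m r : ℕ → ℤ} {i : ℕ} (hi : i ≠ 0) {z : ℤ} :
    cycleC n m r i ∣ z ↔ (m i ∣ z ∧ r (i - 1) ∣ z) ∧
      (∀ k, i + 1 ≤ k → k < n → gcd (m k) ((Finset.Ico i k).gcd r) ∣ z) ∧
      (Finset.Ico i n).gcd r ∣ z := by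
  simp only [cycleC, if_neg hi, lcm_dvd_iff, Finset.lcm_dvd_iff, Finset.mem_Ico, and_imp]

theorem exists_spline_eq_cycleC {n i : ℕ} {m r : ℕ → ℤ} (hi : i < n) :
    ∃ f : ℕ → ℤ,
      ((∀ j < n, m j ∣ f j) ∧
        (∀ j, j + 1 < n → r j ∣ f (j + 1) - f j) ∧
        r (n - 1) ∣ f 0 - f (n - 1)) ∧
      (∀ s < i, f s = 0) ∧ f i = cycleC n m r i := by
  rcases eq_or_ne i 0 with rfl | h0
  · obtain ⟨hc, hcl, hcr⟩ := cycleC_zero_dvd_iff.1 (dvd_refl (cycleC n m r 0))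
    obtain ⟨f, hf, hfm, hfr, hft⟩ := exists_path_spline (t := cycleC n m r 0) hi
      (fun k _ hkn => by
        rcases k.eq_zero_or_pos with rfl | hk
        · simpa using hc
        · exact hcl k hk hkn)
      (by simp) hcr
    refine ⟨f, ⟨fun k => hfm k k.zero_le, fun k => hfr k k.zero_le, ?_⟩, by simp, hf⟩
    rwa [hf, dvd_sub_comm]
  · obtain ⟨⟨hcm, hcr⟩, hcl, hcG⟩ := (cycleC_dvd_iff h0).1 (dvd_refl (cycleC n m r i))
    obtain ⟨f, hf, hfm, hfr, hft⟩ := exists_path_spline (t := 0) hi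
      (fun k hk hkn => by
        rcases hk.eq_or_lt with rfl | hk
        · simpa using hcm
        · exact hcl k hk hkn)
      (by simpa using hcG) (by simp)
    refine ⟨fun k => if k < i then 0 else f k, ⟨fun k hkn => ?_, fun k hkn => ?_, ?_⟩, ?_, ?_⟩
    · rcases lt_or_ge k i with hk | hk
      · simp [hk]
      · simpa [hk.not_gt] using hfm k hk hkn
    · rcases lt_trichotomy (k + 1) i with hk | rfl | hk
      · simp [hk, (Nat.lt_succ_self k).trans hk]
      · simpa [hf] using hcr
      · simpa [hk.not_gt, (Nat.lt_succ_iff.1 hk).not_gt] using hfr k (Nat.lt_succ_iff.1 hk) hkn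
    · simpa [Nat.pos_of_ne_zero h0, (Nat.le_sub_one_of_lt hi).not_gt] using hft
    · exact fun s hs => if_pos hs
    · simpa using hf

theorem cycleC_dvd_of_spline {n i : ℕ} {m r A : ℕ → ℤ} (hi : i < n)
    (hAm : ∀ j < n, m j ∣ A j) (hAr : ∀ j, j + 1 < n → r j ∣ A (j + 1) - A j)
    (hAc : r (n - 1) ∣ A 0 - A (n - 1)) (hA0 : ∀ s < i, A s = 0) : cycleC n m r i ∣ A i := by
  have hleft : ∀ k, i ≤ k → k < n → gcd (m k) ((Finset.Ico i k).gcd r) ∣ A i := by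
    intro k hk hkn
    have h := (gcd_dvd_right (m k) _).trans
      (gcd_Ico_dvd_sub hk fun l _ hlk => hAr l (by omega) : (Finset.Ico i k).gcd r ∣ A k - A i)
    exact (dvd_sub_right ((gcd_dvd_left _ _).trans (hAm k hkn))).1 h
  have hright : ∀ k, k < n → (Finset.Ico k n).gcd r ∣ A 0 - A k := by
    intro k hkn
    have h₁ : (Finset.Ico k n).gcd r ∣ A (n - 1) - A k :=
      (Finset.gcd_mono (Finset.Ico_subset_Ico_right (Nat.sub_le n 1))).trans
        (gcd_Ico_dvd_sub (by omega) fun l _ hl => hAr l (by omega))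
    have h₂ : (Finset.Ico k n).gcd r ∣ A 0 - A (n - 1) :=
      (Finset.gcd_dvd (Finset.mem_Ico.2 ⟨by omega, by omega⟩)).trans hAc
    simpa using dvd_add h₂ h₁
  rcases eq_or_ne i 0 with rfl | h0
  · refine cycleC_zero_dvd_iff.2 ⟨hAm 0 hi, fun k _ => hleft k k.zero_le, fun k _ hkn => ?_⟩
    exact (dvd_sub_left ((gcd_dvd_left _ _).trans (hAm k hkn))).1
      ((gcd_dvd_right _ _).trans (hright k hkn))
  · refine (cycleC_dvd_iff h0).2 ⟨⟨hAm i hi, ?_⟩, fun k hk => hleft k (by omega), ?_⟩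
    · have h := hAr (i - 1) (by omega)
      rwa [Nat.sub_add_cancel (by omega), hA0 (i - 1) (by omega), sub_zero] at h
    · simpa [hA0 0 (Nat.pos_of_ne_zero h0)] using hright i hi

/-- for each `i < n` there is a spline `f` on the edge-labeled
cycle `Cₙ` with `f s = 0` for `s < i` and `f i = c i`; moreover `c i` divides
`A i` for every spline `A` on `Cₙ` vanishing below `i`. -/
theorem cycle_minimal_flowup_exists (n : ℕ) (hn : 3 ≤ n) (m r : ℕ → ℤ)
    (hm : ∀ j < n, m j ≠ 0) (hrne : ∀ j < n, r j ≠ 0) :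
    ∀ i < n, ∃ f : ℕ → ℤ,
      ((∀ j < n, m j ∣ f j) ∧
        (∀ j, j + 1 < n → r j ∣ f (j + 1) - f j) ∧
        r (n - 1) ∣ f 0 - f (n - 1)) ∧
      (∀ s < i, f s = 0) ∧ f i = cycleC n m r i ∧
      ∀ A : ℕ → ℤ,
        ((∀ j < n, m j ∣ A j) ∧
          (∀ j, j + 1 < n → r j ∣ A (j + 1) - A j) ∧
          r (n - 1) ∣ A 0 - A (n - 1)) →
        (∀ s < i, A s = 0) → cycleC n m r i ∣ A i := by
  intro i hi
  obtain ⟨f, hf, hf0, hfi⟩ := exists_spline_eq_cycleC (m := m) (r := r) hi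
  exact ⟨f, hf, hf0, hfi, fun A hA => cycleC_dvd_of_spline hi hA.1 hA.2.1 hA.2.2⟩
end
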